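/- arXiv:1705.02068 — 4 statements merged into one kernel-verified Lean document; each statement's English description precedes it below -/
import Mathlib

section
/- Let Q > 0, X > 0, γ > 0 and Pmax > 0 be real numbers with 0 ≤ Q/X − 1/γ ≤ Pmax, and define f(P) = Q·log(1 + Pγ) − X·P for P ∈ [0, Pmax]. Then the maximum of f over [0, Pmax] equals Q·log Q − Q + X/γ − Q·log(X/γ). -/
open Set

/-- Closed-form optimal value of the water-filling problem (Lemma 2 of the
paper): when the water-filling level `Q/X - 1/γ` lies in `[0, Pmax]`, the
maximum of `f P = Q * log (1 + P*γ) - X*P` over `[0, Pmax]` equals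
`Q * log Q - Q + X/γ - Q * log (X/γ)`. -/
theorem waterfilling_optimal_value
    (Q X γ Pmax : ℝ) (hQ : 0 < Q) (hX : 0 < X) (hγ : 0 < γ) (hPmax : 0 < Pmax)
    (h0 : 0 ≤ Q / X - 1 / γ) (hP : Q / X - 1 / γ ≤ Pmax) :
    IsGreatest ((fun P => Q * Real.log (1 + P * γ) - X * P) '' Set.Icc (0 : ℝ) Pmax)
      (Q * Real.log Q - Q + X / γ - Q * Real.log (X / γ)) := by
  have hXγ : 0 < X / γ := div_pos hX hγ
  refine ⟨⟨Q / X - 1 / γ, ⟨h0, hP⟩, ?_⟩, ?_⟩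
  · have hlevel : 1 + (Q / X - 1 / γ) * γ = Q / (X / γ) := by
      field_simp
      ring
    have hcost : X * (Q / X - 1 / γ) = Q - X / γ := by
      field_simp
    simp only [hlevel, hcost, Real.log_div hQ.ne' hXγ.ne']
    ring
  · rintro _ ⟨P, ⟨hP0, -⟩, rfl⟩
    have hpos : 0 < 1 + P * γ := by positivity
    have hlog := Real.log_le_sub_one_of_pos (div_pos (mul_pos hpos hXγ) hQ)
    rw [Real.log_div (mul_pos hpos hXγ).ne' hQ.ne', Real.log_mul hpos.ne' hXγ.ne'] at hlog
    have hscaled := mul_le_mul_of_nonneg_left hlog hQ.le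
    have hcost : Q * ((1 + P * γ) * (X / γ) / Q - 1) = X / γ + X * P - Q := by
      field_simp
    rw [hcost] at hscaled
    dsimp only
    linarith
end

section
/- Let c > 0 and γ > 0 be real numbers, let log be the natural logarithm, and let z > 1 be the unique real number with z·(log z − 1) = cγ − 1. Set P* = (z − 1)/γ and g(P) = (P + c)/log(1 + Pγ) for P > 0. Then g(P) ≥ g(P*) for all P > 0, with equality only when P = P*; moreover the minimum value is g(P*) = z/γ. -/
open Set

/-- The tangent line of `log` at `z` lies strictly above `log` away from `z`, scaled by `z`. -/
theorem mul_log_lt_add_mul_log_sub {z w : ℝ} (hz : 0 < z) (hw : 0 < w) (hwz : w ≠ z) :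
    z * Real.log w < w + z * Real.log z - z := by
  have h := Real.log_lt_sub_one_of_pos (div_pos hw hz) (by rwa [Ne, div_eq_one_iff_eq hz.ne'])
  rw [Real.log_div hw.ne' hz.ne'] at h
  have h' := mul_lt_mul_of_pos_left h hz
  have hcancel : z * (w / z) = w := mul_div_cancel₀ w hz.ne'
  linarith

/-- Lambert power allocation (unconstrained form, Theorem 1 of the paper):
if `z > 1` solves `z * (log z - 1) = c*γ - 1`, then `P* = (z - 1)/γ` is the
unique minimizer of `g P = (P + c) / log (1 + P*γ)` over `P > 0`, and the
minimum value is `z / γ`. -/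
theorem lambert_power_unique_minimizer
    (c γ z : ℝ) (hc : 0 < c) (hγ : 0 < γ) (hz : 1 < z)
    (hzeq : z * (Real.log z - 1) = c * γ - 1) :
    let g : ℝ → ℝ := fun P => (P + c) / Real.log (1 + P * γ)
    let Pstar : ℝ := (z - 1) / γ
    (∀ P : ℝ, 0 < P → g Pstar ≤ g P) ∧
      (∀ P : ℝ, 0 < P → g P = g Pstar → P = Pstar) ∧
      g Pstar = z / γ := by
  intro g Pstar
  have hval : g Pstar = z / γ := by
    have hw : 1 + (z - 1) / γ * γ = z := by
      rw [div_mul_cancel₀ _ hγ.ne']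
      ring
    simp only [g, Pstar, hw]
    rw [div_eq_div_iff (Real.log_pos hz).ne' hγ.ne', add_mul, div_mul_cancel₀ _ hγ.ne']
    linarith
  have hlt : ∀ P : ℝ, 0 < P → P ≠ Pstar → g Pstar < g P := by
    intro P hP hne
    have hPγ : 0 < P * γ := mul_pos hP hγ
    have hwz : 1 + P * γ ≠ z := by
      intro h
      apply hne
      rw [eq_div_iff hγ.ne']
      linarith
    have h := mul_log_lt_add_mul_log_sub (by linarith) (by linarith) hwz
    rw [hval, div_lt_div_iff₀ hγ (Real.log_pos (by linarith))]
    linarith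
  refine ⟨fun P hP => ?_, fun P hP h => ?_, hval⟩
  · rcases eq_or_ne P Pstar with rfl | hne
    · exact le_rfl
    · exact (hlt P hP hne).le
  · by_contra hne
    exact (hlt P hP hne).ne' h
end

section
/- Let c > 0 and γ > 0 be real numbers with cγ ≠ 1, let log be the natural logarithm, and let w > −1 be a real number with w ≠ 0 satisfying w·exp(w) = (cγ − 1)/e. Then P* = (1/γ)·((cγ − 1)/w − 1) is strictly positive and is the unique minimizer of g(P) = (P + c)/log(1 + Pγ) over P ∈ (0, ∞). -/
open Set

/-- The logarithm lies strictly below its tangent at `exp (w + 1)`, away from the tangency point. -/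
lemma exp_mul_log_lt_add_mul_exp {x w : ℝ} (hx : 0 < x) (hne : x ≠ Real.exp (w + 1)) :
    Real.exp (w + 1) * Real.log x < x + w * Real.exp (w + 1) := by
  have hE : 0 < Real.exp (w + 1) := Real.exp_pos _
  have h := Real.log_lt_sub_one_of_pos (div_pos hx hE)
    (fun h => hne ((div_eq_one_iff_eq hE.ne').mp h))
  rw [Real.log_div hx.ne' hE.ne', Real.log_exp] at h
  have h' : Real.log x - w < x / Real.exp (w + 1) := by linarith
  rw [lt_div_iff₀ hE] at h'
  linarith

/-- Closed-form Lambert power allocation (Theorem 1 of the paper): if `w > -1`,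
`w ≠ 0`, satisfies `w * exp w = (c*γ - 1)/e` (i.e. `w = W₀((c*γ-1)/e)`), then
`P* = (1/γ) * ((c*γ - 1)/w - 1)` is strictly positive and is the unique
minimizer of `g P = (P + c) / log (1 + P*γ)` over `(0, ∞)`. -/
theorem lambert_closed_form_minimizer
    (c γ w : ℝ) (hc : 0 < c) (hγ : 0 < γ) (hne : c * γ ≠ 1)
    (hw1 : -1 < w) (hw0 : w ≠ 0)
    (hw : w * Real.exp w = (c * γ - 1) / Real.exp 1) :
    let g : ℝ → ℝ := fun P => (P + c) / Real.log (1 + P * γ)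
    let Pstar : ℝ := (1 / γ) * ((c * γ - 1) / w - 1)
    0 < Pstar ∧ (∀ P : ℝ, 0 < P → g Pstar ≤ g P) ∧
      (∀ P : ℝ, 0 < P → g P = g Pstar → P = Pstar) := by
  intro g Pstar
  have hE : c * γ - 1 = w * Real.exp (w + 1) := by
    rw [Real.exp_add, ← mul_assoc, hw, div_mul_cancel₀ _ (Real.exp_ne_zero 1)]
  have hPstar : Pstar = (Real.exp (w + 1) - 1) / γ := by
    simp only [Pstar, hE, mul_div_cancel_left₀ _ hw0]
    ring
  have hgstar : g Pstar = Real.exp (w + 1) / γ := by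
    have hx : 1 + Pstar * γ = Real.exp (w + 1) := by
      rw [hPstar, div_mul_cancel₀ _ hγ.ne']
      ring
    have hw' : w + 1 ≠ 0 := by linarith
    simp only [g]
    rw [hx, Real.log_exp, div_eq_div_iff hw' hγ.ne']
    linear_combination hx + hE
  have hlt : ∀ P : ℝ, 0 < P → P ≠ Pstar → g Pstar < g P := by
    intro P hP hPne
    have hPγ : 0 < P * γ := mul_pos hP hγ
    have hlog : 0 < Real.log (1 + P * γ) := Real.log_pos (by linarith)
    have hx : 1 + P * γ ≠ Real.exp (w + 1) := by
      intro h
      apply hPne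
      rw [hPstar, eq_div_iff hγ.ne']
      linarith
    have h := exp_mul_log_lt_add_mul_exp (by linarith) hx
    rw [hgstar, div_lt_div_iff₀ hγ hlog]
    linarith
  refine ⟨?_, fun P hP => ?_, fun P hP h => ?_⟩
  · rw [hPstar]
    exact div_pos (sub_pos.mpr (Real.one_lt_exp_iff.mpr (by linarith))) hγ
  · rcases eq_or_ne P Pstar with rfl | hPne
    · exact le_rfl
    · exact (hlt P hP hPne).le
  · by_contra hPne
    exact (hlt P hP hPne).ne' h
end

section
/- Let c > 0 be a real number and let log be the natural logarithm. Suppose 0 < γ₁ < γ₂ and z₁, z₂ > 1 satisfy zᵢ·(log zᵢ − 1) = cγᵢ − 1 for i = 1, 2. Then (z₁ − 1)/γ₁ > (z₂ − 1)/γ₂; consequently, for every Pmax > 0, min((z₁ − 1)/γ₁, Pmax) ≥ min((z₂ − 1)/γ₂, Pmax). -/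
/-- The secant slope of `x * log x` from the point `1` is strictly increasing on `(1, ∞)`. -/
theorem mul_log_secant_from_one_lt {x y : ℝ} (hx : 1 < x) (hxy : x < y) :
    x * Real.log x * (y - 1) < y * Real.log y * (x - 1) := by
  have h := Real.strictConvexOn_mul_log.secant_strict_mono (a := 1) (x := x) (y := y)
    (Set.mem_Ici.2 zero_le_one) (Set.mem_Ici.2 (by linarith)) (Set.mem_Ici.2 (by linarith))
    hx.ne' (hx.trans hxy).ne' hxy
  simp only [Real.log_one, mul_zero, sub_zero] at h
  rwa [div_lt_div_iff₀ (by linarith) (by linarith)] at h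

/-- Theorem 2 of the paper: the Lambert power allocation
`P(γ) = (z(γ) - 1)/γ`, where `z(γ) > 1` solves `z*(log z - 1) = c*γ - 1`,
is monotonically decreasing in the channel gain `γ`; consequently the
peak-power-capped allocation `min (P(γ)) Pmax` is nonincreasing as well. -/
theorem lambert_power_decreasing_in_gain
    (c γ₁ γ₂ z₁ z₂ : ℝ) (hc : 0 < c) (hγ₁ : 0 < γ₁) (hγ : γ₁ < γ₂)
    (hz₁ : 1 < z₁) (hz₂ : 1 < z₂)
    (heq₁ : z₁ * (Real.log z₁ - 1) = c * γ₁ - 1)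
    (heq₂ : z₂ * (Real.log z₂ - 1) = c * γ₂ - 1) :
    (z₂ - 1) / γ₂ < (z₁ - 1) / γ₁ ∧
      ∀ Pmax : ℝ, 0 < Pmax →
        min ((z₂ - 1) / γ₂) Pmax ≤ min ((z₁ - 1) / γ₁) Pmax := by
  have hlt : z₁ < z₂ := by
    by_contra! hle
    have hcγ : c * γ₁ < c * γ₂ := mul_lt_mul_of_pos_left hγ hc
    rcases hle.eq_or_lt with rfl | hlt
    · linarith
    · have h := mul_log_secant_from_one_lt hz₂ hlt
      have hmul : c * γ₂ * (z₁ - 1) < c * γ₁ * (z₂ - 1) := by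
        linear_combination h - (z₁ - 1) * heq₂ + (z₂ - 1) * heq₁
      have hpos : 0 < c * γ₁ := mul_pos hc hγ₁
      nlinarith
  have hP : (z₂ - 1) / γ₂ < (z₁ - 1) / γ₁ := by
    have h := mul_log_secant_from_one_lt hz₁ hlt
    rw [div_lt_div_iff₀ (hγ₁.trans hγ) hγ₁]
    refine lt_of_mul_lt_mul_left ?_ hc.le
    linear_combination h - (z₂ - 1) * heq₁ + (z₁ - 1) * heq₂
  exact ⟨hP, fun Pmax _ => min_le_min_right Pmax hP.le⟩
end
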